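/- 1D interval problem: let 0 < α < 1, l > 0, f continuous on [−l, l], and c₋⁰, c₊⁰ ∈ ℝ. Then the function u(x) = c₋⁰|x+l|^{α−1} + c₊⁰|x−l|^{α−1} + ∫_{−l}^{l} c_{1,α} f(y)|x−y|^{α−1} dy is a tempered distribution on ℝ satisfying (−Δ)^{α/2}u = f⁰[f] + C₋δ(x+l) + C₊δ(x−l) in S'(ℝ) for suitable constants C₋, C₊; in particular (−Δ)^{α/2}u = f on (−l, l), and lim_{x→∓l}|x±l|^{1−α}u(x) = c∓⁰. -/

import Mathlib

open MeasureTheory Filter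

/-- The 1D Riesz constant `c_{1,α} = Γ((1−α)/2)/(2^α √π Γ(α/2))`. -/
noncomputable def rieszConst1 (α : ℝ) : ℝ :=
  Real.Gamma ((1 - α) / 2) / (2 ^ α * Real.sqrt Real.pi * Real.Gamma (α / 2))

/-- The 1D fractional Laplacian `(−Δ)^{α/2}` (Fourier multiplier `|ξ|^α`),
given for `0 < α < 1` on smooth compactly supported functions by
`(−Δ)^{α/2}φ(x) = C(α) ∫ (φ(x)−φ(y))/|x−y|^{1+α} dy`. -/
noncomputable def fracLap1 (α : ℝ) (φ : ℝ → ℝ) (x : ℝ) : ℝ :=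
  (2 ^ α * Real.Gamma ((1 + α) / 2) /
      (Real.sqrt Real.pi * |Real.Gamma (-α / 2)|)) *
    ∫ y, (φ x - φ y) / |x - y| ^ (1 + α)

theorem integral_rpow_mul_exp_neg_div_Ioi {a k : ℝ} (ha : 0 < a) (hk : 0 < k) :
    ∫ b in Set.Ioi (0 : ℝ), b ^ (-1 - a) * Real.exp (-(k / b)) = Real.Gamma a * k ^ (-a) := by
  rw [← integral_comp_rpow_Ioi (fun b : ℝ => b ^ (-1 - a) * Real.exp (-(k / b)))
    (p := -1) (by norm_num)]
  rw [mul_comm, Real.rpow_neg hk.le, ← Real.inv_rpow hk.le, ← one_div,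
    ← Real.integral_rpow_mul_exp_neg_mul_Ioi ha hk]
  refine setIntegral_congr_fun measurableSet_Ioi (fun x hx => ?_)
  have hx : 0 < x := hx
  simp only [smul_eq_mul, abs_neg, abs_one, one_mul]
  rw [← mul_assoc, ← Real.rpow_mul hx.le, ← Real.rpow_add hx, Real.rpow_neg_one, div_inv_eq_mul]
  congr 2
  ring

theorem integrableOn_rpow_mul_exp_neg_div_Ioi {a k : ℝ} (ha : 0 < a) (hk : 0 < k) :
    IntegrableOn (fun b : ℝ => b ^ (-1 - a) * Real.exp (-(k / b))) (Set.Ioi 0) := by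
  refine Integrable.of_integral_ne_zero ?_
  rw [integral_rpow_mul_exp_neg_div_Ioi ha hk]
  have := Real.Gamma_pos_of_pos ha
  positivity

theorem integrableOn_rpow_mul_exp_neg_mul_Ioi {a k : ℝ} (ha : 0 < a) (hk : 0 < k) :
    IntegrableOn (fun b : ℝ => b ^ (a - 1) * Real.exp (-(k * b))) (Set.Ioi 0) := by
  refine Integrable.of_integral_ne_zero ?_
  rw [Real.integral_rpow_mul_exp_neg_mul_Ioi ha hk]
  have := Real.Gamma_pos_of_pos ha
  positivity

theorem lintegral_rpow_mul_exp_neg_div_Ioi {a k : ℝ} (ha : 0 < a) (hk : 0 < k) :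
    ∫⁻ b in Set.Ioi (0 : ℝ), ENNReal.ofReal (b ^ (-1 - a) * Real.exp (-(k / b))) =
      ENNReal.ofReal (Real.Gamma a * k ^ (-a)) := by
  rw [← integral_rpow_mul_exp_neg_div_Ioi ha hk, ofReal_integral_eq_lintegral_ofReal
    (integrableOn_rpow_mul_exp_neg_div_Ioi ha hk)]
  filter_upwards [ae_restrict_mem measurableSet_Ioi] with b hb
  have : 0 < b := hb
  positivity

theorem lintegral_rpow_mul_exp_neg_mul_Ioi {a k : ℝ} (ha : 0 < a) (hk : 0 < k) :
    ∫⁻ b in Set.Ioi (0 : ℝ), ENNReal.ofReal (b ^ (a - 1) * Real.exp (-(k * b))) =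
      ENNReal.ofReal (Real.Gamma a * k ^ (-a)) := by
  rw [mul_comm, Real.rpow_neg hk.le, ← Real.inv_rpow hk.le, ← one_div,
    ← Real.integral_rpow_mul_exp_neg_mul_Ioi ha hk, ofReal_integral_eq_lintegral_ofReal
    (integrableOn_rpow_mul_exp_neg_mul_Ioi ha hk)]
  filter_upwards [ae_restrict_mem measurableSet_Ioi] with b hb
  have : 0 < b := hb
  positivity

/-- `1 - exp (-k / c)` is the average of `s ↦ exp (-s / c) / c` over `(0, k)`. -/
theorem lintegral_rpow_mul_one_sub_exp_neg_div_Ioi {a k : ℝ} (ha0 : 0 < a) (ha1 : a < 1)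
    (hk : 0 ≤ k) :
    ∫⁻ c in Set.Ioi (0 : ℝ), ENNReal.ofReal (c ^ (a - 1) * (1 - Real.exp (-(k / c)))) =
      ENNReal.ofReal (Real.Gamma (1 - a) / a * k ^ a) := by
  have h1 : ∀ c ∈ Set.Ioi (0 : ℝ),
      ENNReal.ofReal (c ^ (a - 1) * (1 - Real.exp (-(k / c)))) =
        ∫⁻ s in Set.Ioc 0 k, ENNReal.ofReal (c ^ (-1 - (1 - a)) * Real.exp (-(s / c))) := by
    intro c hc
    have hc : 0 < c := hc
    have hd : ∀ s ∈ Set.uIcc 0 k, HasDerivAt (fun s => -(c ^ (a - 1) * Real.exp (-(s / c))))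
        (c ^ (-1 - (1 - a)) * Real.exp (-(s / c))) s := by
      intro s _
      have := ((((hasDerivAt_id s).div_const c).neg.exp).const_mul (c ^ (a - 1))).neg
      refine this.congr_deriv ?_
      rw [show -1 - (1 - a) = (a - 1) - 1 by ring, Real.rpow_sub_one hc.ne' (a - 1)]
      simp only [id, Pi.neg_apply]
      field_simp
    have hi : IntervalIntegrable (fun s => c ^ (-1 - (1 - a)) * Real.exp (-(s / c)))
        volume 0 k := by
      apply Continuous.intervalIntegrable
      fun_prop
    rw [← ofReal_integral_eq_lintegral_ofReal hi.1 (Eventually.of_forall fun s => by positivity),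
      ← intervalIntegral.integral_of_le hk, intervalIntegral.integral_eq_sub_of_hasDerivAt hd hi]
    congr 1
    simp
    ring
  rw [setLIntegral_congr_fun measurableSet_Ioi h1, lintegral_lintegral_swap (by fun_prop)]
  have h2 : ∀ s ∈ Set.Ioc 0 k,
      ∫⁻ c in Set.Ioi (0 : ℝ), ENNReal.ofReal (c ^ (-1 - (1 - a)) * Real.exp (-(s / c))) =
        ENNReal.ofReal (Real.Gamma (1 - a) * s ^ (a - 1)) := by
    intro s hs
    rw [lintegral_rpow_mul_exp_neg_div_Ioi (by linarith) hs.1]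
    congr 3
    ring
  have hG : 0 < Real.Gamma (1 - a) := Real.Gamma_pos_of_pos (by linarith)
  have hi : IntervalIntegrable (fun s : ℝ => Real.Gamma (1 - a) * s ^ (a - 1)) volume 0 k :=
    (intervalIntegral.intervalIntegrable_rpow' (by linarith)).const_mul _
  rw [setLIntegral_congr_fun measurableSet_Ioc h2, ← ofReal_integral_eq_lintegral_ofReal hi.1,
    ← intervalIntegral.integral_of_le hk, intervalIntegral.integral_const_mul,
    integral_rpow (Or.inl (by linarith))]
  · congr 1
    simp [Real.zero_rpow ha0.ne']
    ring
  · filter_upwards [ae_restrict_mem measurableSet_Ioc] with s hs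
    have : 0 < s := hs.1
    positivity

theorem integral_cexp_mul_gaussian {c : ℝ} (hc : 0 < c) (t : ℝ) :
    ∫ x : ℝ, Complex.exp (Complex.I * t * x) * Complex.exp (-c * x ^ 2) =
      ((Real.sqrt (Real.pi / c) * Real.exp (-t ^ 2 / (4 * c)) : ℝ) : ℂ) := by
  rw [fourierIntegral_gaussian (b := (c : ℂ)) (by simpa using hc) (t : ℂ), Real.sqrt_eq_rpow]
  push_cast [Complex.ofReal_cpow (by positivity : 0 ≤ Real.pi / c)]
  rfl

theorem integral_exp_neg_mul_sq_mul_cos {c : ℝ} (hc : 0 < c) (t : ℝ) :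
    ∫ z : ℝ, Real.exp (-c * z ^ 2) * Real.cos (t * z) =
      Real.sqrt (Real.pi / c) * Real.exp (-t ^ 2 / (4 * c)) := by
  have h := integral_cexp_mul_gaussian hc t
  have hint : Integrable
      (fun x : ℝ => Complex.exp (Complex.I * t * x) * Complex.exp (-c * x ^ 2)) := by
    refine Integrable.of_integral_ne_zero ?_
    rw [h]
    norm_cast
    positivity
  have h3 := congrArg Complex.re h
  rw [Complex.ofReal_re] at h3
  rw [← h3, ← RCLike.re_eq_complex_re, ← integral_re hint]
  refine integral_congr_ae (Eventually.of_forall fun z => ?_)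
  simp only [RCLike.re_eq_complex_re]
  rw [show Complex.exp (-c * z ^ 2) = ((Real.exp (-c * z ^ 2) : ℝ) : ℂ) by push_cast; rfl,
    Complex.re_mul_ofReal, show Complex.I * t * z = ((t * z : ℝ) : ℂ) * Complex.I by
      push_cast; ring, Complex.exp_ofReal_mul_I_re]
  ring

theorem integrable_exp_neg_mul_sq_mul_one_sub_cos {c : ℝ} (hc : 0 < c) (t : ℝ) :
    Integrable (fun z : ℝ => Real.exp (-c * z ^ 2) * (1 - Real.cos (t * z))) := by
  refine ((integrable_exp_neg_mul_sq hc).mul_const 2).mono' (by fun_prop)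
    (Eventually.of_forall fun z => ?_)
  rw [norm_mul, Real.norm_of_nonneg (Real.exp_pos _).le,
    Real.norm_of_nonneg (by linarith [Real.cos_le_one (t * z)])]
  gcongr
  linarith [Real.neg_one_le_cos (t * z)]

theorem lintegral_exp_neg_mul_sq_mul_one_sub_cos {c : ℝ} (hc : 0 < c) (t : ℝ) :
    ∫⁻ z : ℝ, ENNReal.ofReal (Real.exp (-c * z ^ 2) * (1 - Real.cos (t * z))) =
      ENNReal.ofReal (Real.sqrt (Real.pi / c) * (1 - Real.exp (-(t ^ 2 / 4 / c)))) := by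
  have h1 : ∀ z, 0 ≤ 1 - Real.cos (t * z) := fun z => by linarith [Real.cos_le_one (t * z)]
  have hint := integrable_exp_neg_mul_sq_mul_one_sub_cos hc t
  rw [← ofReal_integral_eq_lintegral_ofReal hint
    (Eventually.of_forall fun z => mul_nonneg (Real.exp_pos _).le (h1 z))]
  congr 1
  have h2 : (fun z : ℝ => Real.exp (-c * z ^ 2) * Real.cos (t * z)) =
      fun z => Real.exp (-c * z ^ 2) - Real.exp (-c * z ^ 2) * (1 - Real.cos (t * z)) := by
    ext z; ring
  have h3 := integral_exp_neg_mul_sq_mul_cos hc t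
  rw [h2, integral_sub (integrable_exp_neg_mul_sq hc) hint, integral_gaussian] at h3
  rw [show -(t ^ 2 / 4 / c) = -t ^ 2 / (4 * c) by field_simp]
  linarith

theorem abs_rpow_eq_sq_rpow (z p : ℝ) : |z| ^ p = (z ^ 2) ^ (p / 2) := by
  rw [← sq_abs, ← Real.rpow_natCast, ← Real.rpow_mul (abs_nonneg z)]
  congr 1
  push_cast
  ring

theorem lintegral_one_sub_cos_div_abs_rpow {α : ℝ} (hα0 : 0 < α) (hα2 : α < 2) (t : ℝ) :
    ∫⁻ z : ℝ, ENNReal.ofReal ((1 - Real.cos (t * z)) / |z| ^ (1 + α)) =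
      ENNReal.ofReal (Real.sqrt Real.pi * (Real.Gamma (1 - α / 2) / (α / 2)) *
        (t ^ 2 / 4) ^ (α / 2) / Real.Gamma ((1 + α) / 2)) := by
  set G := Real.Gamma ((1 + α) / 2) with hG
  have hGpos : 0 < G := Real.Gamma_pos_of_pos (by linarith)
  have h1 : ∀ z, 0 ≤ 1 - Real.cos (t * z) := fun z => by linarith [Real.cos_le_one (t * z)]
  have hrep : ∀ z : ℝ, z ≠ 0 → ENNReal.ofReal ((1 - Real.cos (t * z)) / |z| ^ (1 + α)) =
      ∫⁻ c in Set.Ioi (0 : ℝ), ENNReal.ofReal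
        (G⁻¹ * c ^ ((1 + α) / 2 - 1) * (Real.exp (-c * z ^ 2) * (1 - Real.cos (t * z)))) := by
    intro z hz
    have hz2 : 0 < z ^ 2 := by positivity
    have e : ∀ c : ℝ, ENNReal.ofReal
        (G⁻¹ * c ^ ((1 + α) / 2 - 1) * (Real.exp (-c * z ^ 2) * (1 - Real.cos (t * z)))) =
        ENNReal.ofReal (G⁻¹ * (1 - Real.cos (t * z))) *
          ENNReal.ofReal (c ^ ((1 + α) / 2 - 1) * Real.exp (-(z ^ 2 * c))) := by
      intro c
      rw [← ENNReal.ofReal_mul (mul_nonneg (by positivity) (h1 z))]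
      congr 1
      rw [show -c * z ^ 2 = -(z ^ 2 * c) by ring]
      ring
    simp_rw [e]
    rw [lintegral_const_mul _ (by fun_prop),
      lintegral_rpow_mul_exp_neg_mul_Ioi (by linarith) hz2,
      ← ENNReal.ofReal_mul (mul_nonneg (by positivity) (h1 z))]
    congr 1
    rw [abs_rpow_eq_sq_rpow, Real.rpow_neg hz2.le, ← hG]
    field_simp
  have hz0 : ∀ᵐ z : ℝ, z ≠ 0 := by
    simp [ae_iff]
  rw [lintegral_congr_ae (hz0.mono hrep), lintegral_lintegral_swap (by fun_prop)]
  have hc : ∀ c ∈ Set.Ioi (0 : ℝ), ∫⁻ z : ℝ, ENNReal.ofReal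
        (G⁻¹ * c ^ ((1 + α) / 2 - 1) * (Real.exp (-c * z ^ 2) * (1 - Real.cos (t * z)))) =
      ENNReal.ofReal (G⁻¹ * Real.sqrt Real.pi) *
        ENNReal.ofReal (c ^ (α / 2 - 1) * (1 - Real.exp (-(t ^ 2 / 4 / c)))) := by
    intro c hc
    have hc : 0 < c := hc
    have hn : 0 ≤ G⁻¹ * c ^ ((1 + α) / 2 - 1) := by positivity
    simp_rw [ENNReal.ofReal_mul hn]
    rw [lintegral_const_mul _ (by fun_prop), lintegral_exp_neg_mul_sq_mul_one_sub_cos hc,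
      ← ENNReal.ofReal_mul hn, ← ENNReal.ofReal_mul (by positivity)]
    congr 1
    rw [Real.sqrt_div Real.pi_pos.le, Real.sqrt_eq_rpow c,
      show (1 + α) / 2 - 1 = (α / 2 - 1) + 1 / 2 by ring, Real.rpow_add hc]
    field_simp
  rw [setLIntegral_congr_fun measurableSet_Ioi hc, lintegral_const_mul _ (by fun_prop),
    lintegral_rpow_mul_one_sub_exp_neg_div_Ioi (by linarith) (by linarith) (by positivity),
    ← ENNReal.ofReal_mul (by positivity)]
  congr 1
  field_simp

/-- The normalising constant of `fracLap1`. -/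
noncomputable def fracLapConst1 (α : ℝ) : ℝ :=
  2 ^ α * Real.Gamma ((1 + α) / 2) / (Real.sqrt Real.pi * |Real.Gamma (-α / 2)|)

theorem fracLapConst1_pos {α : ℝ} (hα0 : 0 < α) (hα2 : α < 2) : 0 < fracLapConst1 α := by
  have h1 : 0 < Real.Gamma ((1 + α) / 2) := Real.Gamma_pos_of_pos (by linarith)
  have h2 : Real.Gamma (-α / 2) ≠ 0 := by
    refine Real.Gamma_ne_zero fun m h => ?_
    rcases m with _ | m
    · simp at h; linarith
    · push_cast at h
      have : (0 : ℝ) ≤ m := m.cast_nonneg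
      linarith
  have := Real.pi_pos
  unfold fracLapConst1
  positivity

theorem lintegral_one_sub_cos_div_abs_rpow_eq {α : ℝ} (hα0 : 0 < α) (hα2 : α < 2) (t : ℝ) :
    ∫⁻ z : ℝ, ENNReal.ofReal ((1 - Real.cos (t * z)) / |z| ^ (1 + α)) =
      ENNReal.ofReal ((fracLapConst1 α)⁻¹ * |t| ^ α) := by
  rw [lintegral_one_sub_cos_div_abs_rpow hα0 hα2]
  congr 1
  have h1 : 0 < Real.Gamma ((1 + α) / 2) := Real.Gamma_pos_of_pos (by linarith)
  have hG : Real.Gamma (1 - α / 2) = -(α / 2) * Real.Gamma (-α / 2) := by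
    rw [show 1 - α / 2 = -α / 2 + 1 by ring, Real.Gamma_add_one (by linarith)]
    ring
  have h2 : 0 < Real.Gamma (1 - α / 2) := Real.Gamma_pos_of_pos (by linarith)
  have h3 : |Real.Gamma (-α / 2)| = Real.Gamma (1 - α / 2) / (α / 2) := by
    rw [hG, abs_of_neg (by nlinarith)]
    field_simp
  rw [fracLapConst1, h3, abs_rpow_eq_sq_rpow t, Real.div_rpow (sq_nonneg t) (by norm_num),
    show (4 : ℝ) = 2 ^ (2 : ℝ) by norm_num, ← Real.rpow_mul (by norm_num : (0 : ℝ) ≤ 2),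
    show 2 * (α / 2) = α by ring]
  field_simp

theorem integrable_one_sub_cos_div_abs_rpow {α : ℝ} (hα0 : 0 < α) (hα2 : α < 2) (t : ℝ) :
    Integrable (fun z : ℝ => (1 - Real.cos (t * z)) / |z| ^ (1 + α)) := by
  refine (lintegral_ofReal_ne_top_iff_integrable ?_ (Eventually.of_forall fun z => ?_)).1 ?_
  · exact Measurable.aestronglyMeasurable (by fun_prop)
  · exact div_nonneg (by linarith [Real.cos_le_one (t * z)]) (by positivity)
  · rw [lintegral_one_sub_cos_div_abs_rpow_eq hα0 hα2]
    exact ENNReal.ofReal_ne_top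

theorem integral_one_sub_cos_div_abs_rpow {α : ℝ} (hα0 : 0 < α) (hα2 : α < 2) (t : ℝ) :
    ∫ z : ℝ, (1 - Real.cos (t * z)) / |z| ^ (1 + α) = (fracLapConst1 α)⁻¹ * |t| ^ α := by
  have := fracLapConst1_pos hα0 hα2
  rw [integral_eq_lintegral_of_nonneg_ae, lintegral_one_sub_cos_div_abs_rpow_eq hα0 hα2,
    ENNReal.toReal_ofReal (by positivity)]
  · exact Eventually.of_forall fun z =>
      div_nonneg (by linarith [Real.cos_le_one (t * z)]) (by positivity)
  · exact Measurable.aestronglyMeasurable (by fun_prop)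

open scoped FourierTransform

theorem integrable_indicator_ball_abs_rpow_neg {p : ℝ} (hp : p < 1) :
    Integrable ((Metric.ball (0 : ℝ) 1).indicator fun z : ℝ => |z| ^ (-p)) := by
  rw [integrable_indicator_iff Metric.isOpen_ball.measurableSet]
  refine integrableOn_ball_of_norm_le_rpow (C := 1) (α := p) (by simp) (by simpa using hp) ?_ ?_
  · refine Eventually.of_forall fun z => ?_
    rw [Real.norm_of_nonneg (by positivity), one_mul, Real.norm_eq_abs]
  · exact Measurable.aestronglyMeasurable (by fun_prop)

theorem integrable_one_add_abs_rpow_neg {α : ℝ} (hα0 : 0 < α) :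
    Integrable (fun z : ℝ => (1 + |z|) ^ (-(1 + α))) := by
  simpa using integrable_one_add_norm (E := ℝ) (μ := volume) (r := 1 + α) (by simpa using hα0)

theorem div_abs_rpow_le {α w z : ℝ} (hα0 : 0 < α) (hz : 1 ≤ |z|) (hw : 0 ≤ w) :
    w / |z| ^ (1 + α) ≤ w * 2 ^ (1 + α) * (1 + |z|) ^ (-(1 + α)) := by
  have h0 : 0 < |z| := by linarith
  rw [Real.rpow_neg (by positivity), mul_assoc, div_eq_mul_inv]
  gcongr
  rw [← div_eq_mul_inv, ← Real.div_rpow (by norm_num) (by positivity), ← Real.inv_rpow h0.le]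
  gcongr
  rw [inv_eq_one_div, div_le_div_iff₀ h0 (by positivity)]
  linarith

theorem integrable_diff_div_abs_rpow {α : ℝ} (hα0 : 0 < α) (hα1 : α < 1) {φ : ℝ → ℝ}
    (hc : Continuous φ) {K B : ℝ} (hK : ∀ x y, |φ x - φ y| ≤ K * |x - y|) (hB : ∀ x, |φ x| ≤ B)
    (x : ℝ) : Integrable (fun z : ℝ => (φ x - φ (x + z)) / |z| ^ (1 + α)) := by
  have hB0 : 0 ≤ B := (abs_nonneg _).trans (hB 0)
  refine (((integrable_indicator_ball_abs_rpow_neg hα1).const_mul K).add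
    ((integrable_one_add_abs_rpow_neg hα0).const_mul (2 * B * 2 ^ (1 + α)))).mono'
    (Measurable.aestronglyMeasurable (by fun_prop)) (Eventually.of_forall fun z => ?_)
  rw [norm_div, Real.norm_eq_abs, Real.norm_of_nonneg (by positivity : 0 ≤ |z| ^ (1 + α))]
  simp only [Pi.add_apply]
  by_cases hz : z ∈ Metric.ball (0 : ℝ) 1
  · rw [Set.indicator_of_mem hz]
    have h1 : |φ x - φ (x + z)| / |z| ^ (1 + α) ≤ K * |z| ^ (-α) := by
      rcases eq_or_ne z 0 with rfl | hz0
      · simp [Real.zero_rpow (by linarith : 1 + α ≠ 0), Real.zero_rpow (by linarith : -α ≠ 0)]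
      · have hp : 0 < |z| := abs_pos.2 hz0
        rw [div_le_iff₀ (by positivity), mul_assoc, ← Real.rpow_add hp]
        have := hK x (x + z)
        simpa using this
    have : 0 ≤ 2 * B * 2 ^ (1 + α) * (1 + |z|) ^ (-(1 + α)) := by positivity
    linarith
  · rw [Set.indicator_of_notMem hz]
    have hz1 : 1 ≤ |z| := by simpa using hz
    have h2 : |φ x - φ (x + z)| ≤ 2 * B := by
      have := abs_sub (φ x) (φ (x + z))
      linarith [hB x, hB (x + z)]
    have h3 := div_abs_rpow_le hα0 hz1 (by positivity : 0 ≤ 2 * B)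
    rw [mul_zero, zero_add]
    refine le_trans ?_ h3
    gcongr

theorem fracLap1_eq_integral_symm {α : ℝ} (hα0 : 0 < α) (hα1 : α < 1) {φ : ℝ → ℝ}
    (hc : Continuous φ) {K B : ℝ} (hK : ∀ x y, |φ x - φ y| ≤ K * |x - y|) (hB : ∀ x, |φ x| ≤ B)
    (x : ℝ) : fracLap1 α φ x =
      fracLapConst1 α * ∫ z, (φ x - (φ (x + z) + φ (x - z)) / 2) / |z| ^ (1 + α) := by
  have h := integrable_diff_div_abs_rpow hα0 hα1 hc hK hB x
  have h1 : ∫ y, (φ x - φ y) / |x - y| ^ (1 + α) =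
      ∫ z, (φ x - φ (x + z)) / |z| ^ (1 + α) := by
    rw [← integral_add_left_eq_self (fun y => (φ x - φ y) / |x - y| ^ (1 + α)) x]
    simp
  have h2 : ∫ z, (φ x - φ (x + z)) / |z| ^ (1 + α) =
      ∫ z, (φ x - φ (x - z)) / |z| ^ (1 + α) := by
    rw [← integral_neg_eq_self]
    simp [sub_eq_add_neg]
  have h3 : Integrable (fun z : ℝ => (φ x - φ (x - z)) / |z| ^ (1 + α)) := by
    simpa [sub_eq_add_neg] using h.comp_neg
  have h4 : ∫ z, (φ x - (φ (x + z) + φ (x - z)) / 2) / |z| ^ (1 + α) =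
      (∫ z, (φ x - φ (x + z)) / |z| ^ (1 + α)) := by
    have : ∀ z, (φ x - (φ (x + z) + φ (x - z)) / 2) / |z| ^ (1 + α) =
        ((φ x - φ (x + z)) / |z| ^ (1 + α) + (φ x - φ (x - z)) / |z| ^ (1 + α)) / 2 := by
      intro z; ring
    simp_rw [this]
    rw [integral_div, integral_add h h3, ← h2]
    ring
  rw [h4, ← h1]
  rfl

theorem fracLap1_eq_fourier {α : ℝ} (hα0 : 0 < α) (hα1 : α < 1) {φ : ℝ → ℝ}
    (hc : Continuous φ) {K B : ℝ} (hK : ∀ x y, |φ x - φ y| ≤ K * |x - y|) (hB : ∀ x, |φ x| ≤ B)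
    {ψ : ℝ → ℂ} (hψ : Integrable ψ)
    (hψα : Integrable fun ξ : ℝ => ((|2 * Real.pi * ξ| ^ α : ℝ) : ℂ) * ψ ξ)
    (hφψ : ∀ x, (φ x : ℂ) = 𝓕 ψ x) (x : ℝ) :
    (fracLap1 α φ x : ℂ) = 𝓕 (fun ξ : ℝ => ((|2 * Real.pi * ξ| ^ α : ℝ) : ℂ) * ψ ξ) x := by
  have hC := fracLapConst1_pos hα0 (by linarith : α < 2)
  have hE : ∀ y, Integrable fun ξ : ℝ =>
      Complex.exp (↑(-2 * Real.pi * ξ * y) * Complex.I) * ψ ξ := by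
    intro y
    refine hψ.norm.mono' (AEStronglyMeasurable.mul (by fun_prop) hψ.1)
      (Eventually.of_forall fun ξ => ?_)
    rw [norm_mul, Complex.norm_exp_ofReal_mul_I, one_mul]
  have hφ' : ∀ y, (φ y : ℂ) =
      ∫ ξ : ℝ, Complex.exp (↑(-2 * Real.pi * ξ * y) * Complex.I) * ψ ξ := by
    intro y
    rw [hφψ, Real.fourier_real_eq_integral_exp_smul]
    rfl
  set F : ℝ → ℝ → ℂ := fun z ξ => Complex.exp (↑(-2 * Real.pi * ξ * x) * Complex.I) * ψ ξ *
    (((1 - Real.cos (2 * Real.pi * ξ * z)) / |z| ^ (1 + α) : ℝ) : ℂ) with hF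
  have hdiff : ∀ z, (((φ x - (φ (x + z) + φ (x - z)) / 2) / |z| ^ (1 + α) : ℝ) : ℂ) =
      ∫ ξ, F z ξ := by
    intro z
    push_cast
    have hsum : Integrable fun ξ : ℝ =>
        (Complex.exp (↑(-2 * Real.pi * ξ * (x + z)) * Complex.I) * ψ ξ +
          Complex.exp (↑(-2 * Real.pi * ξ * (x - z)) * Complex.I) * ψ ξ) / 2 :=
      ((hE _).add (hE _)).div_const 2
    rw [hφ' x, hφ' (x + z), hφ' (x - z), ← integral_add (hE _) (hE _), ← integral_div,
      ← integral_sub (hE _) hsum, ← integral_div]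
    refine integral_congr_ae (Eventually.of_forall fun ξ => ?_)
    simp only [hF]
    have e1 : ((-2 * Real.pi * ξ * (x + z) : ℝ) : ℂ) * Complex.I =
        ((-2 * Real.pi * ξ * x : ℝ) : ℂ) * Complex.I +
          -((2 * Real.pi * ξ * z : ℝ) : ℂ) * Complex.I := by push_cast; ring
    have e2 : ((-2 * Real.pi * ξ * (x - z) : ℝ) : ℂ) * Complex.I =
        ((-2 * Real.pi * ξ * x : ℝ) : ℂ) * Complex.I +
          ((2 * Real.pi * ξ * z : ℝ) : ℂ) * Complex.I := by push_cast; ring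
    rw [e1, e2, Complex.exp_add, Complex.exp_add, Complex.ofReal_div, Complex.ofReal_sub,
      Complex.ofReal_cos, Complex.cos]
    push_cast
    ring
  have hnorm : ∀ z ξ, ‖F z ξ‖ = ‖ψ ξ‖ * ((1 - Real.cos (2 * Real.pi * ξ * z)) / |z| ^ (1 + α)) := by
    intro z ξ
    rw [hF]
    simp only
    rw [norm_mul, norm_mul, Complex.norm_exp_ofReal_mul_I, one_mul, Complex.norm_real,
      Real.norm_of_nonneg]
    exact div_nonneg (by linarith [Real.cos_le_one (2 * Real.pi * ξ * z)]) (by positivity)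
  have hFint : Integrable (Function.uncurry F) (volume.prod volume) := by
    have hm : AEStronglyMeasurable (Function.uncurry F) (volume.prod volume) := by
      refine AEStronglyMeasurable.mul (AEStronglyMeasurable.mul ?_ hψ.1.comp_snd) ?_
      · exact Continuous.aestronglyMeasurable (by fun_prop)
      · exact Measurable.aestronglyMeasurable (by fun_prop)
    refine (integrable_prod_iff' hm).2 ⟨Eventually.of_forall fun ξ => ?_, ?_⟩
    · exact ((integrable_one_sub_cos_div_abs_rpow hα0 (by linarith : α < 2)
        (2 * Real.pi * ξ)).ofReal (𝕜 := ℂ)).const_mul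
          (Complex.exp (↑(-2 * Real.pi * ξ * x) * Complex.I) * ψ ξ)
    · simp only [Function.uncurry, hnorm]
      simp_rw [integral_const_mul, integral_one_sub_cos_div_abs_rpow hα0 (by linarith : α < 2)]
      refine (hψα.norm.const_mul (fracLapConst1 α)⁻¹).congr (Eventually.of_forall fun ξ => ?_)
      simp only [norm_mul, Complex.norm_real]
      rw [Real.norm_of_nonneg (by positivity)]
      ring
  rw [fracLap1_eq_integral_symm hα0 hα1 hc hK hB, Complex.ofReal_mul, ← integral_complex_ofReal]
  simp_rw [hdiff]
  rw [integral_integral_swap hFint, Real.fourier_real_eq_integral_exp_smul, ← integral_const_mul]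
  refine integral_congr_ae (Eventually.of_forall fun ξ => ?_)
  simp only [hF, smul_eq_mul]
  rw [integral_const_mul, integral_complex_ofReal,
    integral_one_sub_cos_div_abs_rpow hα0 (by linarith : α < 2)]
  have : (fracLapConst1 α : ℂ) ≠ 0 := by exact_mod_cast hC.ne'
  push_cast
  field_simp

theorem indicator_ball_compl_abs_rpow_le_one {α : ℝ} (hα1 : α < 1) (z : ℝ) :
    ‖(Metric.ball (0 : ℝ) 1)ᶜ.indicator (fun z : ℝ => |z| ^ (α - 1)) z‖ ≤ 1 := by
  by_cases hz : z ∈ (Metric.ball (0 : ℝ) 1)ᶜ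
  · have h1 : 1 ≤ |z| := by simpa using hz
    rw [Set.indicator_of_mem hz, Real.norm_of_nonneg (by positivity)]
    exact Real.rpow_le_one_of_one_le_of_nonpos h1 (by linarith)
  · rw [Set.indicator_of_notMem hz]
    simp

theorem integrable_indicator_ball_abs_rpow {α : ℝ} (hα0 : 0 < α) :
    Integrable ((Metric.ball (0 : ℝ) 1).indicator fun z : ℝ => |z| ^ (α - 1)) := by
  simpa using integrable_indicator_ball_abs_rpow_neg (by linarith : 1 - α < 1)

theorem measurable_indicator_ball_compl_abs_rpow (α : ℝ) :
    Measurable ((Metric.ball (0 : ℝ) 1)ᶜ.indicator fun z : ℝ => |z| ^ (α - 1)) :=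
  Measurable.indicator (by fun_prop) Metric.isOpen_ball.measurableSet.compl

theorem integrable_abs_sub_rpow_mul {α : ℝ} (hα0 : 0 < α) (hα1 : α < 1) {g : ℝ → ℝ} {B : ℝ}
    (hg : Integrable g) (hB : ∀ x, ‖g x‖ ≤ B) (y : ℝ) :
    Integrable (fun x => |x - y| ^ (α - 1) * g x) := by
  have h1 := ((integrable_indicator_ball_abs_rpow hα0).comp_sub_right y).mul_bdd (c := B) hg.1
    (Eventually.of_forall hB)
  have h2 := hg.bdd_mul (c := 1)
    ((measurable_indicator_ball_compl_abs_rpow α).comp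
      (measurable_id.sub_const y)).aestronglyMeasurable
    (Eventually.of_forall fun x => indicator_ball_compl_abs_rpow_le_one hα1 (x - y))
  refine (h1.add h2).congr (Eventually.of_forall fun x => ?_)
  simp only [Pi.add_apply, Function.comp, id]
  rw [← add_mul]
  congr 1
  exact congrFun (Set.indicator_self_add_compl (Metric.ball (0 : ℝ) 1)
    (fun z : ℝ => |z| ^ (α - 1))) (x - y)

theorem integrable_prod_mul_abs_sub_rpow {α : ℝ} (hα0 : 0 < α) (hα1 : α < 1) {F g : ℝ → ℝ}
    {B : ℝ} (hF : Integrable F) (hg : Integrable g) (hB : ∀ x, ‖g x‖ ≤ B) :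
    Integrable (fun p : ℝ × ℝ => g p.1 * (F p.2 * |p.1 - p.2| ^ (α - 1)))
      (volume.prod volume) := by
  have h1 := (hF.convolution_integrand (ContinuousLinearMap.mul ℝ ℝ)
    (integrable_indicator_ball_abs_rpow hα0)).bdd_mul (c := B) (f := fun p => g p.1) hg.1.comp_fst
      (Eventually.of_forall fun p => hB p.1)
  have h2 := (hg.mul_prod hF).mul_bdd (c := 1)
    (g := fun p : ℝ × ℝ => (Metric.ball (0 : ℝ) 1)ᶜ.indicator
      (fun z : ℝ => |z| ^ (α - 1)) (p.1 - p.2))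
    ((measurable_indicator_ball_compl_abs_rpow α).comp
      (measurable_fst.sub measurable_snd)).aestronglyMeasurable
    (Eventually.of_forall fun p => indicator_ball_compl_abs_rpow_le_one hα1 (p.1 - p.2))
  refine (h1.add h2).congr (Eventually.of_forall fun p => ?_)
  have := congrFun (Set.indicator_self_add_compl (Metric.ball (0 : ℝ) 1)
    (fun z : ℝ => |z| ^ (α - 1))) (p.1 - p.2)
  simp only [Pi.add_apply, ContinuousLinearMap.mul_apply'] at this ⊢
  rw [← this]
  ring

theorem rieszConst1_pos {α : ℝ} (hα0 : 0 < α) (hα1 : α < 1) : 0 < rieszConst1 α := by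
  have h1 : 0 < Real.Gamma ((1 - α) / 2) := Real.Gamma_pos_of_pos (by linarith)
  have h2 : 0 < Real.Gamma (α / 2) := Real.Gamma_pos_of_pos (by linarith)
  have := Real.pi_pos
  unfold rieszConst1
  positivity

theorem integral_gaussian_mul_fourier {h : ℝ → ℂ} (hh : Integrable h) {b : ℝ} (hb : 0 < b) :
    ∫ x : ℝ, (Real.exp (-(x ^ 2 * b)) : ℂ) * 𝓕 h x =
      ∫ ξ : ℝ, h ξ * ((Real.sqrt (Real.pi / b) * Real.exp (-((Real.pi * ξ) ^ 2 / b)) : ℝ) : ℂ) := by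
  have hG : Integrable (fun x : ℝ => (Real.exp (-(x ^ 2 * b)) : ℂ)) := by
    have hr : Integrable (fun x : ℝ => Real.exp (-(x ^ 2 * b))) :=
      (integrable_exp_neg_mul_sq hb).congr (Eventually.of_forall fun x => by simp only; ring_nf)
    exact hr.ofReal (𝕜 := ℂ)
  have hflip := VectorFourier.integral_fourierIntegral_smul_eq_flip (L := innerₗ ℝ)
    (μ := volume) (ν := volume) Real.continuous_fourierChar continuous_inner hh hG
  have hl : ∀ x, VectorFourier.fourierIntegral Real.fourierChar volume (innerₗ ℝ) h x = 𝓕 h x :=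
    fun x => rfl
  have hr : ∀ ξ, VectorFourier.fourierIntegral Real.fourierChar volume (innerₗ ℝ).flip
      (fun x : ℝ => (Real.exp (-(x ^ 2 * b)) : ℂ)) ξ =
      𝓕 (fun x : ℝ => (Real.exp (-(x ^ 2 * b)) : ℂ)) ξ := by
    intro ξ
    rw [flip_innerₗ]
    rfl
  simp only [hl, hr, smul_eq_mul] at hflip
  calc _ = ∫ x : ℝ, 𝓕 h x * (Real.exp (-(x ^ 2 * b)) : ℂ) := by simp_rw [mul_comm]
    _ = _ := hflip
    _ = _ := by
      refine integral_congr_ae (Eventually.of_forall fun ξ => ?_)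
      simp only
      congr 1
      have h1 := integral_cexp_mul_gaussian hb (-2 * Real.pi * ξ)
      rw [show -((Real.pi * ξ) ^ 2 / b) = -(-2 * Real.pi * ξ) ^ 2 / (4 * b) by field_simp; ring,
        ← h1, Real.fourier_real_eq_integral_exp_smul]
      refine integral_congr_ae (Eventually.of_forall fun x => ?_)
      simp only [smul_eq_mul]
      push_cast
      congr 2 <;> ring

theorem integral_abs_rpow_mul_eq {α : ℝ} (hα0 : 0 < α) (hα1 : α < 1) {g : ℝ → ℝ} {ψ : ℝ → ℂ}
    (hψ : Integrable ψ)
    (hψα : Integrable fun ξ : ℝ => ((|2 * Real.pi * ξ| ^ α : ℝ) : ℂ) * ψ ξ)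
    (hg : ∀ x, (g x : ℂ) = 𝓕 (fun ξ : ℝ => ((|2 * Real.pi * ξ| ^ α : ℝ) : ℂ) * ψ ξ) x)
    (hgi : Integrable (fun x => |x| ^ (α - 1) * g x)) (hgm : AEStronglyMeasurable g) :
    ((∫ x, |x| ^ (α - 1) * g x : ℝ) : ℂ) = ((rieszConst1 α)⁻¹ : ℝ) * ∫ ξ, ψ ξ := by
  set h := fun ξ : ℝ => ((|2 * Real.pi * ξ| ^ α : ℝ) : ℂ) * ψ ξ with hh
  set β := (1 - α) / 2 with hβ
  have hβ0 : 0 < β := by rw [hβ]; linarith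
  have hG1 : 0 < Real.Gamma β := Real.Gamma_pos_of_pos hβ0
  have hG2 : 0 < Real.Gamma (α / 2) := Real.Gamma_pos_of_pos (by linarith)
  have hne : ∀ᵐ z : ℝ, z ≠ 0 := by simp [ae_iff]
  have hpow : ∀ x : ℝ, x ≠ 0 → (x ^ 2) ^ (-β) = |x| ^ (α - 1) := by
    intro x _
    rw [abs_rpow_eq_sq_rpow]
    congr 1
    rw [hβ]; ring
  have hin : ∀ x : ℝ, x ≠ 0 → ∫ b in Set.Ioi (0 : ℝ), b ^ (β - 1) * Real.exp (-(x ^ 2 * b)) =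
      Real.Gamma β * |x| ^ (α - 1) := by
    intro x hx
    have hx2 : 0 < x ^ 2 := by positivity
    rw [Real.integral_rpow_mul_exp_neg_mul_Ioi hβ0 hx2, ← hpow x hx, Real.rpow_neg hx2.le, one_div,
      Real.inv_rpow hx2.le, mul_comm]
  set F : ℝ → ℝ → ℂ := fun x b => ((b ^ (β - 1) * Real.exp (-(x ^ 2 * b)) : ℝ) : ℂ) * (g x : ℂ)
    with hF
  have hFint : Integrable (Function.uncurry F) (volume.prod (volume.restrict (Set.Ioi 0))) := by
    have hm : AEStronglyMeasurable (Function.uncurry F)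
        (volume.prod (volume.restrict (Set.Ioi 0))) := by
      refine AEStronglyMeasurable.mul ?_
        (Complex.continuous_ofReal.comp_aestronglyMeasurable hgm).comp_fst
      exact Measurable.aestronglyMeasurable (by fun_prop)
    refine (integrable_prod_iff hm).2 ⟨?_, ?_⟩
    · filter_upwards [hne] with x hx
      exact (Integrable.ofReal (𝕜 := ℂ) (integrableOn_rpow_mul_exp_neg_mul_Ioi hβ0
        (by positivity : 0 < x ^ 2))).mul_const (g x : ℂ)
    · refine (hgi.norm.const_mul (Real.Gamma β)).congr ?_
      filter_upwards [hne] with x hx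
      have : ∀ b ∈ Set.Ioi (0 : ℝ), ‖Function.uncurry F (x, b)‖ =
          b ^ (β - 1) * Real.exp (-(x ^ 2 * b)) * ‖g x‖ := by
        intro b hb
        have hb : 0 < b := hb
        simp only [Function.uncurry, hF, norm_mul, Complex.norm_real]
        rw [Real.norm_of_nonneg (by positivity : 0 ≤ b ^ (β - 1)), Real.norm_of_nonneg
          (Real.exp_pos _).le]
      rw [setIntegral_congr_fun measurableSet_Ioi this, integral_mul_const, hin x hx, norm_mul,
        Real.norm_of_nonneg (by positivity : 0 ≤ |x| ^ (α - 1))]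
      ring
  have hleft : ∫ x, ∫ b in Set.Ioi (0 : ℝ), F x b =
      Real.Gamma β * ((∫ x, |x| ^ (α - 1) * g x : ℝ) : ℂ) := by
    rw [← integral_complex_ofReal, ← integral_const_mul]
    refine integral_congr_ae ?_
    filter_upwards [hne] with x hx
    simp only [hF]
    rw [integral_mul_const, integral_complex_ofReal, hin x hx]
    push_cast
    ring
  set H : ℝ → ℝ → ℂ := fun b ξ => h ξ *
    ((Real.sqrt Real.pi * (b ^ (-1 - α / 2) * Real.exp (-((Real.pi * ξ) ^ 2 / b))) : ℝ) : ℂ)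
    with hH
  have hmid : ∀ b ∈ Set.Ioi (0 : ℝ), ∫ x, F x b = ∫ ξ, H b ξ := by
    intro b hb
    have hb : 0 < b := hb
    have e1 : ∀ x, F x b = ((b ^ (β - 1) : ℝ) : ℂ) * ((Real.exp (-(x ^ 2 * b)) : ℂ) * 𝓕 h x) := by
      intro x
      simp only [hF]
      rw [hg x]
      push_cast
      ring
    simp_rw [e1]
    rw [integral_const_mul, integral_gaussian_mul_fourier hψα hb, ← integral_const_mul]
    refine integral_congr_ae (Eventually.of_forall fun ξ => ?_)
    simp only [hH]
    rw [mul_left_comm, ← Complex.ofReal_mul]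
    congr 2
    rw [Real.sqrt_div Real.pi_pos.le, Real.sqrt_eq_rpow b,
      show -1 - α / 2 = (β - 1) - 1 / 2 by rw [hβ]; ring, Real.rpow_sub hb (β - 1) (1 / 2)]
    ring
  have hinξ : ∀ ξ : ℝ, ξ ≠ 0 → ∫ b in Set.Ioi (0 : ℝ),
      Real.sqrt Real.pi * (b ^ (-1 - α / 2) * Real.exp (-((Real.pi * ξ) ^ 2 / b))) =
      2 ^ α * Real.sqrt Real.pi * Real.Gamma (α / 2) / |2 * Real.pi * ξ| ^ α := by
    intro ξ hξ
    have hπ := Real.pi_pos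
    have hp : 0 < (Real.pi * ξ) ^ 2 := by positivity
    have h2 : |2 * Real.pi * ξ| ^ α = 2 ^ α * ((Real.pi * ξ) ^ 2) ^ (α / 2) := by
      rw [mul_assoc, abs_mul, abs_of_pos (by norm_num : (0 : ℝ) < 2), Real.mul_rpow (by norm_num)
        (abs_nonneg _), abs_rpow_eq_sq_rpow]
    rw [integral_const_mul, integral_rpow_mul_exp_neg_div_Ioi (by linarith) hp, h2,
      Real.rpow_neg hp.le]
    field_simp
  have hHint : Integrable (Function.uncurry H) ((volume.restrict (Set.Ioi 0)).prod volume) := by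
    have hm : AEStronglyMeasurable (Function.uncurry H)
        ((volume.restrict (Set.Ioi 0)).prod volume) := by
      refine AEStronglyMeasurable.mul hψα.1.comp_snd ?_
      exact Measurable.aestronglyMeasurable (by fun_prop)
    refine (integrable_prod_iff' hm).2 ⟨?_, ?_⟩
    · filter_upwards [hne] with ξ hξ
      have hp : 0 < (Real.pi * ξ) ^ 2 := by
        have := Real.pi_pos
        positivity
      exact (Integrable.ofReal (𝕜 := ℂ) ((integrableOn_rpow_mul_exp_neg_div_Ioi
        (by linarith : 0 < α / 2) hp).const_mul (Real.sqrt Real.pi))).const_mul (h ξ)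
    · refine (hψ.norm.const_mul (2 ^ α * Real.sqrt Real.pi * Real.Gamma (α / 2))).congr ?_
      filter_upwards [hne] with ξ hξ
      have : ∀ b ∈ Set.Ioi (0 : ℝ), ‖Function.uncurry H (b, ξ)‖ = ‖h ξ‖ *
          (Real.sqrt Real.pi * (b ^ (-1 - α / 2) * Real.exp (-((Real.pi * ξ) ^ 2 / b)))) := by
        intro b hb
        have hb : 0 < b := hb
        simp only [Function.uncurry, hH]
        rw [norm_mul, Complex.norm_real, Real.norm_of_nonneg (by positivity)]
      have hpos : 0 < |2 * Real.pi * ξ| ^ α := by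
        have := Real.pi_pos
        positivity
      rw [setIntegral_congr_fun measurableSet_Ioi this, integral_const_mul, hinξ ξ hξ, hh]
      simp only [norm_mul, Complex.norm_real]
      rw [Real.norm_of_nonneg hpos.le]
      field_simp
  have hright : ∫ ξ, ∫ b in Set.Ioi (0 : ℝ), H b ξ =
      ((2 ^ α * Real.sqrt Real.pi * Real.Gamma (α / 2) : ℝ) : ℂ) * ∫ ξ, ψ ξ := by
    rw [← integral_const_mul]
    refine integral_congr_ae ?_
    filter_upwards [hne] with ξ hξ
    have hpos : 0 < |2 * Real.pi * ξ| ^ α := by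
      have := Real.pi_pos
      positivity
    have hposC : ((|2 * Real.pi * ξ| ^ α : ℝ) : ℂ) ≠ 0 := by exact_mod_cast hpos.ne'
    simp only [hH]
    rw [integral_const_mul, integral_complex_ofReal, hinξ ξ hξ, Complex.ofReal_div, hh]
    field_simp
  have key : (Real.Gamma β : ℂ) * ((∫ x, |x| ^ (α - 1) * g x : ℝ) : ℂ) =
      ((2 ^ α * Real.sqrt Real.pi * Real.Gamma (α / 2) : ℝ) : ℂ) * ∫ ξ, ψ ξ := by
    rw [← hleft, integral_integral_swap hFint, setIntegral_congr_fun measurableSet_Ioi hmid,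
      integral_integral_swap hHint, hright]
  have hGC : (Real.Gamma β : ℂ) ≠ 0 := by exact_mod_cast hG1.ne'
  rw [rieszConst1, ← hβ, inv_div, Complex.ofReal_div, div_mul_eq_mul_div, eq_div_iff hGC, ← key,
    mul_comm]

theorem exists_integrable_fourier_eq {α : ℝ} (hα0 : 0 < α) (hα1 : α < 1) {φ : ℝ → ℝ}
    (hφ : ContDiff ℝ (⊤ : ℕ∞) φ) (hs : HasCompactSupport φ) :
    ∃ ψ : ℝ → ℂ, Integrable ψ ∧
      (Integrable fun ξ : ℝ => ((|2 * Real.pi * ξ| ^ α : ℝ) : ℂ) * ψ ξ) ∧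
      ∀ x, (φ x : ℂ) = 𝓕 ψ x := by
  have hs' : HasCompactSupport (Complex.ofRealCLM ∘ φ) := hs.comp_left rfl
  set Φ : SchwartzMap ℝ ℂ := hs'.toSchwartzMap (Complex.ofRealCLM.contDiff.comp hφ) with hΦ
  set Ψ : SchwartzMap ℝ ℂ := 𝓕⁻ Φ with hΨ
  refine ⟨Ψ, Ψ.integrable, ?_, fun x => ?_⟩
  · have h1 := Ψ.integrable_pow_mul volume 1
    refine (Ψ.integrable.norm.add (h1.const_mul (2 * Real.pi))).mono'
      (AEStronglyMeasurable.mul (Measurable.aestronglyMeasurable (by fun_prop))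
        Ψ.integrable.1) (Eventually.of_forall fun ξ => ?_)
    have hπ := Real.pi_pos
    have h2 : |2 * Real.pi * ξ| ^ α ≤ 1 + |2 * Real.pi * ξ| := by
      rcases le_total |2 * Real.pi * ξ| 1 with h | h
      · exact (Real.rpow_le_one (abs_nonneg _) h hα0.le).trans
          (by linarith [abs_nonneg (2 * Real.pi * ξ)])
      · have := Real.rpow_le_rpow_of_exponent_le h hα1.le
        rw [Real.rpow_one] at this
        linarith
    have h3 : |2 * Real.pi * ξ| = 2 * Real.pi * |ξ| := by
      rw [abs_mul, abs_of_pos (by positivity)]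
    rw [norm_mul, Complex.norm_real, Real.norm_of_nonneg (by positivity)]
    simp only [Pi.add_apply, pow_one, Real.norm_eq_abs]
    calc _ ≤ (1 + |2 * Real.pi * ξ|) * ‖Ψ ξ‖ := by gcongr
      _ = _ := by rw [h3]; ring
  · rw [← SchwartzMap.fourier_coe, hΨ, FourierTransform.fourier_fourierInv_eq]
    rfl

theorem exists_lipschitz_bound {φ : ℝ → ℝ} (hφ : ContDiff ℝ (⊤ : ℕ∞) φ)
    (hs : HasCompactSupport φ) :
    ∃ K B : ℝ, (∀ x y, |φ x - φ y| ≤ K * |x - y|) ∧ ∀ x, |φ x| ≤ B := by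
  obtain ⟨K, hK⟩ := hφ.lipschitzWith_of_hasCompactSupport hs (by simp)
  obtain ⟨B, hB⟩ := hs.exists_bound_of_continuous hφ.continuous
  exact ⟨K, B, fun x y => by simpa [Real.dist_eq] using hK.dist_le_mul x y, hB⟩

theorem continuous_fracLap1 {α : ℝ} (hα0 : 0 < α) (hα1 : α < 1) {φ : ℝ → ℝ}
    (hφ : ContDiff ℝ (⊤ : ℕ∞) φ) (hs : HasCompactSupport φ) : Continuous (fracLap1 α φ) := by
  obtain ⟨ψ, hψ, hψα, h⟩ := exists_integrable_fourier_eq hα0 hα1 hφ hs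
  obtain ⟨K, B, hK, hB⟩ := exists_lipschitz_bound hφ hs
  have h1 := VectorFourier.fourierIntegral_continuous (μ := volume) (L := innerₗ ℝ)
    Real.continuous_fourierChar continuous_inner hψα
  refine (Complex.continuous_re.comp h1).congr fun x => ?_
  exact congrArg Complex.re (fracLap1_eq_fourier hα0 hα1 hφ.continuous hK hB hψ hψα h x).symm

theorem exists_bound_fracLap1 {α : ℝ} (hα0 : 0 < α) (hα1 : α < 1) {φ : ℝ → ℝ}
    (hφ : ContDiff ℝ (⊤ : ℕ∞) φ) (hs : HasCompactSupport φ) :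
    ∃ B, ∀ x, ‖fracLap1 α φ x‖ ≤ B := by
  obtain ⟨ψ, hψ, hψα, h⟩ := exists_integrable_fourier_eq hα0 hα1 hφ hs
  obtain ⟨K, B, hK, hB⟩ := exists_lipschitz_bound hφ hs
  refine ⟨∫ ξ, ‖((|2 * Real.pi * ξ| ^ α : ℝ) : ℂ) * ψ ξ‖, fun x => ?_⟩
  rw [← Complex.norm_real, fracLap1_eq_fourier hα0 hα1 hφ.continuous hK hB hψ hψα h x]
  exact VectorFourier.norm_fourierIntegral_le_integral_norm Real.fourierChar volume (innerₗ ℝ) _ x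

theorem integrable_fracLap1 {α : ℝ} (hα0 : 0 < α) (hα1 : α < 1) {φ : ℝ → ℝ}
    (hφ : ContDiff ℝ (⊤ : ℕ∞) φ) (hs : HasCompactSupport φ) : Integrable (fracLap1 α φ) := by
  obtain ⟨R, hR⟩ := hs.isCompact.isBounded.subset_closedBall 0
  have hzero : ∀ x, R < |x| → φ x = 0 := by
    intro x hx
    refine image_eq_zero_of_notMem_tsupport fun hmem => ?_
    have := hR hmem
    rw [mem_closedBall_zero_iff, Real.norm_eq_abs] at this
    linarith
  have hφi : Integrable φ := hφ.continuous.integrable_of_hasCompactSupport hs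
  have hg : Integrable fun x : ℝ => (1 + |x / 2|) ^ (-(1 + α)) :=
    (integrable_one_add_abs_rpow_neg hα0).comp_div two_ne_zero
  refine (continuous_fracLap1 hα0 hα1 hφ hs).locallyIntegrable.integrable_of_isBigO_cocompact ?_
    (hg.integrableAtFilter _)
  set A := ∫ y, ‖φ y‖ with hA
  have hA0 : 0 ≤ A := integral_nonneg fun _ => norm_nonneg _
  refine Asymptotics.IsBigO.of_bound (fracLapConst1 α * (A * 2 ^ (1 + α))) ?_
  filter_upwards [(tendsto_norm_cocompact_atTop (E := ℝ)).eventually_ge_atTop (2 * |R| + 2)]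
    with x hx
  rw [Real.norm_eq_abs] at hx
  have hR' := abs_nonneg R
  have hRle := le_abs_self R
  have hx0 : φ x = 0 := hzero x (by linarith)
  have hx2 : |x / 2| = |x| / 2 := by rw [abs_div, abs_two]
  have hx1 : 1 ≤ |x / 2| := by rw [hx2]; linarith
  have hpos : 0 < |x / 2| := by linarith
  have hbound : ‖∫ y, (φ x - φ y) / |x - y| ^ (1 + α)‖ ≤ A / |x / 2| ^ (1 + α) := by
    rw [hA, ← integral_div]
    refine norm_integral_le_of_norm_le (hφi.norm.div_const _) (Eventually.of_forall fun y => ?_)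
    rw [hx0, zero_sub, norm_div, norm_neg,
      Real.norm_of_nonneg (by positivity : 0 ≤ |x - y| ^ (1 + α))]
    by_cases hy : R < |y|
    · simp [hzero y hy]
    · have : |x / 2| ≤ |x - y| := by
        have := abs_sub_abs_le_abs_sub x y
        rw [hx2]
        linarith
      gcongr
  have hC := fracLapConst1_pos hα0 (by linarith : α < 2)
  have hd := div_abs_rpow_le hα0 hx1 hA0
  rw [Real.norm_of_nonneg (by positivity : 0 ≤ (1 + |x / 2|) ^ (-(1 + α)))]
  change ‖fracLapConst1 α * _‖ ≤ _
  rw [norm_mul, Real.norm_of_nonneg hC.le, mul_assoc]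
  gcongr
  exact hbound.trans hd

theorem integral_abs_sub_rpow_mul_fracLap1 {α : ℝ} (hα0 : 0 < α) (hα1 : α < 1) {φ : ℝ → ℝ}
    (hφ : ContDiff ℝ (⊤ : ℕ∞) φ) (hs : HasCompactSupport φ) (y : ℝ) :
    ∫ x, |x - y| ^ (α - 1) * fracLap1 α φ x = (rieszConst1 α)⁻¹ * φ y := by
  have hφ' : ContDiff ℝ (⊤ : ℕ∞) fun x => φ (x + y) := hφ.comp (contDiff_id.add contDiff_const)
  have hs' : HasCompactSupport fun x => φ (x + y) := hs.comp_homeomorph (Homeomorph.addRight y)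
  have htr : ∀ x, fracLap1 α (fun x => φ (x + y)) x = fracLap1 α φ (x + y) := by
    intro x
    unfold fracLap1
    rw [← integral_add_right_eq_self (fun z => (φ (x + y) - φ z) / |x + y - z| ^ (1 + α)) y]
    simp only [add_sub_add_right_eq_sub]
  obtain ⟨ψ, hψ, hψα, h⟩ := exists_integrable_fourier_eq hα0 hα1 hφ' hs'
  obtain ⟨K, B, hK, hB⟩ := exists_lipschitz_bound hφ' hs'
  obtain ⟨D, hD⟩ := exists_bound_fracLap1 hα0 hα1 hφ' hs'
  have hint := integrable_abs_sub_rpow_mul hα0 hα1 (integrable_fracLap1 hα0 hα1 hφ' hs') hD 0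
  simp only [sub_zero] at hint
  have h0 := integral_abs_rpow_mul_eq hα0 hα1 hψ hψα
    (fracLap1_eq_fourier hα0 hα1 hφ'.continuous hK hB hψ hψα h) hint
    (continuous_fracLap1 hα0 hα1 hφ' hs').aestronglyMeasurable
  have h1 : ∫ ξ, ψ ξ = (φ y : ℂ) := by
    have := h 0
    rw [zero_add, Real.fourier_real_eq_integral_exp_smul] at this
    simpa using this.symm
  rw [h1, ← Complex.ofReal_mul, Complex.ofReal_inj] at h0
  rw [← h0, ← integral_add_right_eq_self _ y]
  simp only [add_sub_cancel_right, htr]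

theorem locallyIntegrable_abs_sub_rpow {α : ℝ} (hα0 : 0 < α) (hα1 : α < 1) (y : ℝ) :
    LocallyIntegrable (fun x : ℝ => |x - y| ^ (α - 1)) := by
  have h1 := ((integrable_indicator_ball_abs_rpow hα0).comp_sub_right y).locallyIntegrable
  have h2 : LocallyIntegrable (fun x : ℝ => (Metric.ball (0 : ℝ) 1)ᶜ.indicator
      (fun z : ℝ => |z| ^ (α - 1)) (x - y)) :=
    (locallyIntegrable_const (1 : ℝ)).mono
      ((measurable_indicator_ball_compl_abs_rpow α).comp
        (measurable_id.sub_const y)).aestronglyMeasurable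
      (Eventually.of_forall fun x => by
        simpa using indicator_ball_compl_abs_rpow_le_one hα1 (x - y))
  have h : (fun x : ℝ => |x - y| ^ (α - 1)) = _ := funext fun x =>
    (congrFun (Set.indicator_self_add_compl (Metric.ball (0 : ℝ) 1)
      (fun z : ℝ => |z| ^ (α - 1))) (x - y)).symm
  rw [h]
  exact h1.add h2

theorem exists_bound_integral_mul_abs_sub_rpow {α : ℝ} (hα0 : 0 < α) (hα1 : α < 1) {F : ℝ → ℝ}
    {A : ℝ} (hF : Integrable F) (hA : ∀ y, ‖F y‖ ≤ A) :
    ∃ D, ∀ x, ‖∫ y, F y * |x - y| ^ (α - 1)‖ ≤ D := by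
  have hk := integrable_indicator_ball_abs_rpow hα0
  have hA0 : 0 ≤ A := (norm_nonneg _).trans (hA 0)
  refine ⟨(∫ z, A * (Metric.ball (0 : ℝ) 1).indicator (fun z : ℝ => |z| ^ (α - 1)) z) +
    ∫ y, ‖F y‖, fun x => ?_⟩
  rw [← integral_sub_left_eq_self
    (fun z => A * (Metric.ball (0 : ℝ) 1).indicator (fun z : ℝ => |z| ^ (α - 1)) z) volume x,
    ← integral_add ((hk.comp_sub_left x).const_mul A) hF.norm]
  refine norm_integral_le_of_norm_le (((hk.comp_sub_left x).const_mul A).add hF.norm)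
    (Eventually.of_forall fun y => ?_)
  rw [norm_mul, Real.norm_of_nonneg (by positivity : 0 ≤ |x - y| ^ (α - 1))]
  by_cases hz : x - y ∈ Metric.ball (0 : ℝ) 1
  · rw [Set.indicator_of_mem hz]
    have h1 : ‖F y‖ * |x - y| ^ (α - 1) ≤ A * |x - y| ^ (α - 1) := by
      gcongr
      exact hA y
    linarith [norm_nonneg (F y)]
  · rw [Set.indicator_of_notMem hz, mul_zero, zero_add]
    have h1 : 1 ≤ |x - y| := by simpa using hz
    exact mul_le_of_le_one_right (norm_nonneg _)
      (Real.rpow_le_one_of_one_le_of_nonpos h1 (by linarith))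

theorem aestronglyMeasurable_integral_mul_abs_sub_rpow {α : ℝ} {F : ℝ → ℝ} (hF : Integrable F) :
    AEStronglyMeasurable fun x : ℝ => ∫ y, F y * |x - y| ^ (α - 1) :=
  AEStronglyMeasurable.integral_prod_right' (f := fun p : ℝ × ℝ => F p.2 * |p.1 - p.2| ^ (α - 1))
    (hF.1.comp_snd.mul (Measurable.aestronglyMeasurable (by fun_prop)))

theorem integral_integral_mul_abs_sub_rpow_mul_fracLap1 {α : ℝ} (hα0 : 0 < α) (hα1 : α < 1)
    {F φ : ℝ → ℝ} (hF : Integrable F) (hφ : ContDiff ℝ (⊤ : ℕ∞) φ) (hs : HasCompactSupport φ) :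
    Integrable (fun x => (∫ y, F y * |x - y| ^ (α - 1)) * fracLap1 α φ x) ∧
      ∫ x, (∫ y, F y * |x - y| ^ (α - 1)) * fracLap1 α φ x =
        (rieszConst1 α)⁻¹ * ∫ y, F y * φ y := by
  obtain ⟨B, hB⟩ := exists_bound_fracLap1 hα0 hα1 hφ hs
  have hp := integrable_prod_mul_abs_sub_rpow hα0 hα1 hF (integrable_fracLap1 hα0 hα1 hφ hs) hB
  have hx : ∀ x, (∫ y, F y * |x - y| ^ (α - 1)) * fracLap1 α φ x =
      ∫ y, fracLap1 α φ x * (F y * |x - y| ^ (α - 1)) := by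
    intro x
    rw [integral_const_mul, mul_comm]
  simp_rw [hx]
  refine ⟨hp.integral_prod_left, ?_⟩
  rw [integral_integral_swap hp, ← integral_const_mul]
  refine integral_congr_ae (Eventually.of_forall fun y => ?_)
  simp only
  rw [mul_left_comm, ← integral_abs_sub_rpow_mul_fracLap1 hα0 hα1 hφ hs y, ← integral_const_mul]
  refine integral_congr_ae (Eventually.of_forall fun x => ?_)
  simp only
  ring

theorem tendsto_abs_sub_rpow_mul {α : ℝ} (hα1 : α < 1) {a b c d D : ℝ} (hab : a ≠ b)
    {V : ℝ → ℝ} (hV : ∀ x, ‖V x‖ ≤ D) :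
    Tendsto (fun x => |x - a| ^ (1 - α) *
      (c * |x - a| ^ (α - 1) + d * |x - b| ^ (α - 1) + V x)) (nhdsWithin a {a}ᶜ) (nhds c) := by
  have h0 : Tendsto (fun x => |x - a| ^ (1 - α)) (nhdsWithin a {a}ᶜ) (nhds 0) := by
    have : ContinuousAt (fun x : ℝ => |x - a| ^ (1 - α)) a :=
      ContinuousAt.rpow_const (by fun_prop) (Or.inr (by linarith))
    have h := this.tendsto
    simp only [sub_self, abs_zero, Real.zero_rpow (by linarith : 1 - α ≠ 0)] at h
    exact h.mono_left nhdsWithin_le_nhds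
  have hb : Tendsto (fun x => d * |x - b| ^ (α - 1)) (nhdsWithin a {a}ᶜ)
      (nhds (d * |a - b| ^ (α - 1))) := by
    have : ContinuousAt (fun x : ℝ => d * |x - b| ^ (α - 1)) a :=
      ContinuousAt.mul (by fun_prop) (ContinuousAt.rpow_const (by fun_prop)
        (Or.inl (abs_ne_zero.2 (sub_ne_zero.2 hab))))
    exact this.tendsto.mono_left nhdsWithin_le_nhds
  have hV0 : Tendsto (fun x => |x - a| ^ (1 - α) * V x) (nhdsWithin a {a}ᶜ) (nhds 0) :=
    h0.zero_mul_isBoundedUnder_le ⟨D, eventually_map.2 (Eventually.of_forall hV)⟩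
  have h := ((tendsto_const_nhds (x := c)).add (h0.mul hb)).add hV0
  rw [zero_mul, add_zero, add_zero] at h
  refine h.congr' ?_
  filter_upwards [self_mem_nhdsWithin] with x hx
  have hx' : 0 < |x - a| := abs_pos.2 (sub_ne_zero.2 hx)
  have h1 : |x - a| ^ (1 - α) * |x - a| ^ (α - 1) = 1 := by
    rw [← Real.rpow_add hx']
    simp
  linear_combination (-c) * h1

/-- **The 1D interval problem**: for `0 < α < 1`, `l > 0`, `f` continuous on
`[−l,l]` and constants `c₋⁰, c₊⁰`, the function
`u(x) = c₋⁰|x+l|^{α−1} + c₊⁰|x−l|^{α−1} + ∫_{−l}^{l} c_{1,α} f(y)|x−y|^{α−1} dy`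
is a (locally integrable, hence tempered) distribution on `ℝ` with
`(−Δ)^{α/2}u = f⁰[f] + C₋δ(x+l) + C₊δ(x−l)` in `S'(ℝ)` for suitable constants
`C₋, C₊`; in particular `(−Δ)^{α/2}u = f` on `(−l,l)`, and
`lim_{x→∓l}|x±l|^{1−α}u(x) = c∓⁰`. -/
theorem interval_fractional_dirichlet_solution
    {α : ℝ} (hα0 : 0 < α) (hα1 : α < 1) {l : ℝ} (hl : 0 < l)
    (cm cp : ℝ) (f : ℝ → ℝ) (hfc : ContinuousOn f (Set.Icc (-l) l))
    (u : ℝ → ℝ)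
    (hu : ∀ x, u x = cm * |x + l| ^ (α - 1) + cp * |x - l| ^ (α - 1) +
      ∫ y in Set.Icc (-l) l, rieszConst1 α * f y * |x - y| ^ (α - 1)) :
    LocallyIntegrable u volume ∧
      (∃ Cm Cp : ℝ,
        ∀ φ : ℝ → ℝ, ContDiff ℝ (⊤ : ℕ∞) φ → HasCompactSupport φ →
          (∫ x, u x * fracLap1 α φ x) =
            (∫ x, (if x ∈ Set.Ioo (-l) l then f x else 0) * φ x) +
              Cm * φ (-l) + Cp * φ l) ∧
      (∀ φ : ℝ → ℝ, ContDiff ℝ (⊤ : ℕ∞) φ → HasCompactSupport φ →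
        tsupport φ ⊆ Set.Ioo (-l) l →
          (∫ x, u x * fracLap1 α φ x) =
            ∫ x, (if x ∈ Set.Ioo (-l) l then f x else 0) * φ x) ∧
      Tendsto (fun x => |x + l| ^ (1 - α) * u x)
        (nhdsWithin (-l) {(-l)}ᶜ) (nhds cm) ∧
      Tendsto (fun x => |x - l| ^ (1 - α) * u x)
        (nhdsWithin l {l}ᶜ) (nhds cp) := by
  have hc := rieszConst1_pos hα0 hα1
  obtain ⟨A, hA⟩ := isCompact_Icc.exists_bound_of_continuousOn hfc
  set F : ℝ → ℝ := (Set.Icc (-l) l).indicator fun y => rieszConst1 α * f y with hFdef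
  have hF : Integrable F := (integrable_indicator_iff measurableSet_Icc).2
    ((hfc.integrableOn_compact isCompact_Icc).const_mul (rieszConst1 α))
  have hFA : ∀ y, ‖F y‖ ≤ rieszConst1 α * A := by
    intro y
    have hA0 : 0 ≤ A := (norm_nonneg _).trans (hA l ⟨by linarith, le_rfl⟩)
    by_cases hy : y ∈ Set.Icc (-l) l
    · rw [hFdef, Set.indicator_of_mem hy, norm_mul, Real.norm_of_nonneg hc.le]
      gcongr
      exact hA y hy
    · rw [hFdef, Set.indicator_of_notMem hy, norm_zero]
      positivity
  obtain ⟨D, hD⟩ := exists_bound_integral_mul_abs_sub_rpow hα0 hα1 hF hFA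
  have hu' : u = fun x => cm * |x - -l| ^ (α - 1) + cp * |x - l| ^ (α - 1) +
      ∫ y, F y * |x - y| ^ (α - 1) := by
    ext x
    rw [hu x, sub_neg_eq_add, ← integral_indicator measurableSet_Icc]
    congr 2
    ext y
    by_cases hy : y ∈ Set.Icc (-l) l <;> simp [hFdef, hy]
  have hpair : ∀ φ : ℝ → ℝ, ContDiff ℝ (⊤ : ℕ∞) φ → HasCompactSupport φ →
      (∫ x, u x * fracLap1 α φ x) = (∫ x, (if x ∈ Set.Ioo (-l) l then f x else 0) * φ x) +
        cm * (rieszConst1 α)⁻¹ * φ (-l) + cp * (rieszConst1 α)⁻¹ * φ l := by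
    intro φ hφ hs
    obtain ⟨B, hB⟩ := exists_bound_fracLap1 hα0 hα1 hφ hs
    have hL := integrable_fracLap1 hα0 hα1 hφ hs
    have h1 := fun y => integrable_abs_sub_rpow_mul hα0 hα1 hL hB y
    obtain ⟨h2, h3⟩ := integral_integral_mul_abs_sub_rpow_mul_fracLap1 hα0 hα1 hF hφ hs
    have h4 : (rieszConst1 α)⁻¹ * ∫ y, F y * φ y =
        ∫ x, (if x ∈ Set.Ioo (-l) l then f x else 0) * φ x := by
      have e1 : ∀ x, (if x ∈ Set.Ioo (-l) l then f x else 0) * φ x =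
          (Set.Ioo (-l) l).indicator (fun x => f x * φ x) x := by
        intro x
        by_cases hx : x ∈ Set.Ioo (-l) l <;> simp [hx]
      have e2 : ∀ x, (rieszConst1 α)⁻¹ * (F x * φ x) =
          (Set.Icc (-l) l).indicator (fun x => f x * φ x) x := by
        intro x
        by_cases hx : x ∈ Set.Icc (-l) l
        · rw [hFdef, Set.indicator_of_mem hx, Set.indicator_of_mem hx]
          field_simp
        · rw [hFdef, Set.indicator_of_notMem hx, Set.indicator_of_notMem hx]
          simp
      simp_rw [e1]
      rw [← integral_const_mul]
      simp_rw [e2]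
      rw [integral_indicator measurableSet_Icc, integral_indicator measurableSet_Ioo,
        integral_Icc_eq_integral_Ioo]
    have hsplit : ∀ x, u x * fracLap1 α φ x = cm * (|x - -l| ^ (α - 1) * fracLap1 α φ x) +
        cp * (|x - l| ^ (α - 1) * fracLap1 α φ x) +
          (∫ y, F y * |x - y| ^ (α - 1)) * fracLap1 α φ x := by
      intro x
      rw [hu']
      ring
    simp_rw [hsplit]
    have h5 : Integrable fun x => cm * (|x - -l| ^ (α - 1) * fracLap1 α φ x) +
        cp * (|x - l| ^ (α - 1) * fracLap1 α φ x) :=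
      ((h1 (-l)).const_mul cm).add ((h1 l).const_mul cp)
    rw [integral_add h5 h2,
      integral_add ((h1 (-l)).const_mul cm) ((h1 l).const_mul cp), integral_const_mul,
      integral_const_mul, integral_abs_sub_rpow_mul_fracLap1 hα0 hα1 hφ hs,
      integral_abs_sub_rpow_mul_fracLap1 hα0 hα1 hφ hs, h3, h4]
    ring
  refine ⟨?_, ⟨_, _, hpair⟩, fun φ hφ hs hsupp => ?_, ?_, ?_⟩
  · have hV : LocallyIntegrable fun x => ∫ y, F y * |x - y| ^ (α - 1) :=
      (locallyIntegrable_const D).mono (aestronglyMeasurable_integral_mul_abs_sub_rpow hF)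
        (Eventually.of_forall fun x => (hD x).trans (le_abs_self D))
    rw [hu']
    exact (((locallyIntegrable_abs_sub_rpow hα0 hα1 (-l)).smul cm).add
      ((locallyIntegrable_abs_sub_rpow hα0 hα1 l).smul cp)).add hV
  · rw [hpair φ hφ hs, image_eq_zero_of_notMem_tsupport fun h => (hsupp h).1.false,
      image_eq_zero_of_notMem_tsupport fun h => (hsupp h).2.false]
    simp
  · have := tendsto_abs_sub_rpow_mul hα1 (c := cm) (d := cp) (by linarith : -l ≠ l) hD
    rw [hu']
    simpa only [sub_neg_eq_add] using this
  · have := tendsto_abs_sub_rpow_mul hα1 (c := cp) (d := cm) (by linarith : l ≠ -l) hD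
    rw [hu']
    refine this.congr fun x => ?_
    ring
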